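/- arXiv:2402.16337 — 2 statements merged into one kernel-verified Lean document; each statement's English description precedes it below -/
import Mathlib

section
/- Let u : ℝ → ℝᵐ and x : ℝ → ℝⁿ be differentiable at t, and let γ : ℝⁿ → ℝᵐ be Lipschitz with constant L on an open set containing x(t). Define e(s) = u(s) − γ(x(s)). Then the upper right Dini derivative of s ↦ ‖e(s)‖ at t satisfies D⁺‖e‖(t) ≤ ‖u'(t)‖ + L ‖x'(t)‖. -/
/-- The upper right Dini derivative `D⁺f(t) = limsup_{h → 0⁺} (f(t+h) − f(t))/h`,
valued in `EReal`. -/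
noncomputable def diniUpper (f : ℝ → ℝ) (t : ℝ) : EReal :=
  Filter.limsup (fun h : ℝ => (((f (t + h) - f t) / h : ℝ) : EReal))
    (nhdsWithin 0 (Set.Ioi 0))

/-- If `u` and `x` are differentiable at `t` and `γ` is Lipschitz with
constant `L` on an open set containing `x(t)`, then the actuation error
`e(s) = u(s) − γ(x(s))` satisfies `D⁺‖e‖(t) ≤ ‖u'(t)‖ + L ‖x'(t)‖`. -/
theorem dini_actuation_error_bound (n m : ℕ)
    (u : ℝ → EuclideanSpace ℝ (Fin m)) (x : ℝ → EuclideanSpace ℝ (Fin n))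
    (γ : EuclideanSpace ℝ (Fin n) → EuclideanSpace ℝ (Fin m)) (L : ℝ) (hL : 0 ≤ L)
    (U : Set (EuclideanSpace ℝ (Fin n))) (hU : IsOpen U)
    (t : ℝ) (hxt : x t ∈ U)
    (hLip : ∀ y ∈ U, ∀ z ∈ U, ‖γ y - γ z‖ ≤ L * ‖y - z‖)
    (u' : EuclideanSpace ℝ (Fin m)) (hu : HasDerivAt u u' t)
    (x' : EuclideanSpace ℝ (Fin n)) (hx : HasDerivAt x x' t) :
    diniUpper (fun s : ℝ => ‖u s - γ (x s)‖) t ≤ ((‖u'‖ + L * ‖x'‖ : ℝ) : EReal) := by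
  have hG : Filter.Tendsto
      (fun h : ℝ => ‖h⁻¹ • (u (t + h) - u t)‖ + L * ‖h⁻¹ • (x (t + h) - x t)‖)
      (nhdsWithin 0 (Set.Ioi 0)) (nhds (‖u'‖ + L * ‖x'‖)) :=
    hu.tendsto_slope_zero_right.norm.add (hx.tendsto_slope_zero_right.norm.const_mul L)
  have hGE := (continuous_coe_real_ereal.tendsto _).comp hG
  rw [← hGE.limsup_eq]
  have hU' : ∀ᶠ h : ℝ in nhdsWithin 0 (Set.Ioi 0), x (t + h) ∈ U := by
    have hc : Filter.Tendsto (fun h : ℝ => x (t + h)) (nhds 0) (nhds (x t)) := by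
      refine hx.continuousAt.tendsto.comp ?_
      simpa using (continuous_const_add t).tendsto 0
    exact (hc.mono_left nhdsWithin_le_nhds).eventually (hU.mem_nhds hxt)
  refine Filter.limsup_le_limsup ?_
  filter_upwards [hU', self_mem_nhdsWithin] with h hhU hh
  have hpos : (0 : ℝ) < h := hh
  refine EReal.coe_le_coe_iff.2 ?_
  have hnorm : ‖u (t + h) - γ (x (t + h))‖ - ‖u t - γ (x t)‖
      ≤ ‖u (t + h) - u t‖ + L * ‖x (t + h) - x t‖ :=
    calc ‖u (t + h) - γ (x (t + h))‖ - ‖u t - γ (x t)‖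
        ≤ ‖(u (t + h) - γ (x (t + h))) - (u t - γ (x t))‖ := norm_sub_norm_le _ _
      _ = ‖(u (t + h) - u t) - (γ (x (t + h)) - γ (x t))‖ := by congr 1; abel
      _ ≤ ‖u (t + h) - u t‖ + ‖γ (x (t + h)) - γ (x t)‖ := norm_sub_le _ _
      _ ≤ ‖u (t + h) - u t‖ + L * ‖x (t + h) - x t‖ := by
        gcongr
        exact hLip _ hhU _ hxt
  beta_reduce
  rw [norm_smul, norm_smul, Real.norm_of_nonneg (inv_nonneg.2 hpos.le), div_eq_inv_mul]
  calc h⁻¹ * (‖u (t + h) - γ (x (t + h))‖ - ‖u t - γ (x t)‖)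
      ≤ h⁻¹ * (‖u (t + h) - u t‖ + L * ‖x (t + h) - x t‖) := by gcongr
    _ = h⁻¹ * ‖u (t + h) - u t‖ + L * (h⁻¹ * ‖x (t + h) - x t‖) := by ring
end

section
/- Let f : [0, ∞) → ℝ be continuous, let ε ∈ ℝ and δ > 0, and suppose that for every t ≥ 0 with f(t) ≥ ε, the upper right Dini derivative satisfies D⁺f(t) ≤ −δ. Then f(t) ≤ ε for all t ≥ max{0, (f(0) − ε)/δ}. -/
open Filter Topology Set in
theorem eventually_slope_lt_of_diniUpper_lt {f : ℝ → ℝ} {x r : ℝ}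
    (h : diniUpper f x < (r : EReal)) : ∀ᶠ z in 𝓝[>] x, slope f x z < r := by
  have h₁ := eventually_lt_of_limsup_lt h
  have h₂ : Tendsto (fun z : ℝ => z - x) (𝓝[>] x) (𝓝[>] 0) := by
    refine tendsto_nhdsWithin_iff.2 ⟨?_, ?_⟩
    · have : Tendsto (fun z : ℝ => z - x) (𝓝 x) (𝓝 (x - x)) :=
        (continuous_id.sub continuous_const).tendsto x
      rw [sub_self] at this
      exact this.mono_left nhdsWithin_le_nhds
    · filter_upwards [self_mem_nhdsWithin] with z hz
      exact sub_pos.2 (mem_Ioi.1 hz)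
  filter_upwards [h₂.eventually h₁] with z hz
  rw [slope_def_field]
  simpa only [add_sub_cancel, EReal.coe_lt_coe_iff] using hz

open Filter Topology Set in
theorem le_sub_mul_of_diniUpper_le {f : ℝ → ℝ} {a b δ : ℝ} (hab : a ≤ b)
    (hf : ContinuousOn f (Icc a b))
    (h : ∀ x ∈ Ico a b, diniUpper f x ≤ ((-δ : ℝ) : EReal)) :
    f b ≤ f a - δ * (b - a) := by
  refine image_le_of_liminf_slope_right_le_deriv_boundary
    (B := fun x => f a - δ * (x - a)) (B' := fun _ => -δ) hf (by simp)
    (by fun_prop) (fun x _ => ?_) (fun x hx r hr => ?_) (right_mem_Icc.2 hab)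
  · simpa using (((hasDerivWithinAt_id x (Ici x)).sub_const a).const_mul δ).const_sub (f a)
  · exact (eventually_slope_lt_of_diniUpper_lt
      ((h x hx).trans_lt (EReal.coe_lt_coe_iff.2 hr))).frequently

/-- Ultimate boundedness. If `f` is continuous on `[0, ∞)` and
`D⁺f(t) ≤ −δ` (with `δ > 0`) whenever `t ≥ 0` and `f(t) ≥ ε`, then `f(t) ≤ ε` for all
`t ≥ max{0, (f(0) − ε)/δ}`. -/
theorem ultimate_boundedness (f : ℝ → ℝ) (hf : ContinuousOn f (Set.Ici 0))
    (ε δ : ℝ) (hδ : 0 < δ)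
    (hdini : ∀ t : ℝ, 0 ≤ t → ε ≤ f t → diniUpper f t ≤ ((-δ : ℝ) : EReal)) :
    ∀ t : ℝ, max 0 ((f 0 - ε) / δ) ≤ t → f t ≤ ε := by
  intro t ht
  obtain ⟨ht0, ht1⟩ := max_le_iff.1 ht
  rw [div_le_iff₀ hδ] at ht1
  have decay : ∀ a, 0 ≤ a → a ≤ t → (∀ x ∈ Set.Ico a t, ε ≤ f x) →
      f t ≤ f a - δ * (t - a) := fun a ha hat hge =>
    le_sub_mul_of_diniUpper_le hat (hf.mono fun x hx => ha.trans hx.1)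
      fun x hx => hdini x (ha.trans hx.1) (hge x hx)
  have hft : ContinuousOn f (Set.Icc 0 t) := hf.mono fun x hx => hx.1
  by_cases hne : (Set.Icc 0 t ∩ f ⁻¹' Set.Iic ε).Nonempty
  · obtain ⟨u, ⟨hu, hfu⟩, hmax⟩ := (isCompact_Icc.of_isClosed_subset
      (hft.preimage_isClosed_of_isClosed isClosed_Icc isClosed_Iic)
      Set.inter_subset_left).exists_isGreatest hne
    replace hfu : f u ≤ ε := hfu
    have hgt : ∀ x, u < x → x ≤ t → ε < f x := fun x hux hxt => by
      by_contra! hx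
      exact hux.not_ge (hmax ⟨⟨hu.1.trans hux.le, hxt⟩, hx⟩)
    rcases hu.2.eq_or_lt with rfl | hut
    · exact hfu
    have hεu : ε ≤ f u := by
      have := left_nhdsWithin_Ioo_neBot hut
      refine ge_of_tendsto ((hft u hu).mono (show Set.Ioo u t ⊆ Set.Icc 0 t from fun x hx =>
        ⟨hu.1.trans hx.1.le, hx.2.le⟩)) ?_
      filter_upwards [self_mem_nhdsWithin] with x hx
      exact (hgt x hx.1 hx.2.le).le
    have := decay u hu.1 hut.le fun x hx => by
      rcases hx.1.eq_or_lt with rfl | hux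
      · exact hεu
      · exact (hgt x hux hx.2.le).le
    nlinarith [mul_pos hδ (sub_pos.2 hut)]
  · have := decay 0 le_rfl ht0 fun x hx => by
      by_contra! h
      exact hne ⟨x, ⟨hx.1, hx.2.le⟩, h.le⟩
    linarith
end
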